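/- Assume χ_σ^ω = χ_σ for all ω ∈ W_0. Then for every ω ∈ W_0 and a ∈ S_ω, the vector γ·a := (1−a_{N-1}, a_1−a_{N-1}, a_2−a_{N-1}, …, a_{N-2}−a_{N-1}) lies in S_{ω ω_2} and f_{ω,a}|T_γ = f_{ω ω_2, γ·a}. -/

import Mathlib

open Matrix

noncomputable section

namespace IH

variable (p : ℕ) [Fact p.Prime]

/-- `\bar{𝔽}_p`, an algebraic closure of the residue field. -/
abbrev kb := AlgebraicClosure (ZMod p)

variable (N : ℕ)

/-- `G = GL_N(F)` with `F = ℚ_p`. -/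
abbrev GG := GL (Fin N) ℚ_[p]
/-- `GL_N(O_F)` (as an abstract group, mapping onto `K ⊆ G`). -/
abbrev MM := GL (Fin N) ℤ_[p]
/-- `GL_N(k_F)`. -/
abbrev Gk := GL (Fin N) (ZMod p)

/-- The inclusion `GL_N(O_F) → GL_N(F)`. -/
def iotaM : MM p N →* GG p N := Matrix.GeneralLinearGroup.map (PadicInt.Coe.ringHom)

/-- The reduction map `red : GL_N(O_F) → GL_N(k_F)`. -/
def redM : MM p N →* Gk p N := Matrix.GeneralLinearGroup.map (PadicInt.toZMod)

/-- Elements of `GL_N(O_F)` whose reduction is upper triangular: the Iwahori condition. -/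
def Ipre : Set (MM p N) :=
  {m | ∀ i j : Fin N, j < i → ((redM p N m : Matrix (Fin N) (Fin N) (ZMod p)) i j = 0)}

/-- Elements of `GL_N(O_F)` whose reduction is upper triangular unipotent: pro-p Iwahori. -/
def I1pre : Set (MM p N) :=
  {m | m ∈ Ipre p N ∧ ∀ i : Fin N, ((redM p N m : Matrix (Fin N) (Fin N) (ZMod p)) i i = 1)}

/-- Elements of `GL_N(O_F)` reducing to the identity: `K_1 = ker red`. -/
def K1pre : Set (MM p N) := {m | redM p N m = 1}

/-- `K = GL_N(O_F)` as a subset of `G`. -/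
def Kset : Set (GG p N) := Set.range (iotaM p N)
/-- The Iwahori subgroup `I ⊆ G`. -/
def Iset : Set (GG p N) := iotaM p N '' Ipre p N
/-- The pro-p Iwahori subgroup `I_1 ⊆ G`. -/
def I1set : Set (GG p N) := iotaM p N '' I1pre p N
/-- `K_1 ⊆ G`. -/
def K1set : Set (GG p N) := iotaM p N '' K1pre p N

/-- The uniformizer `ϖ = p` as a unit of `ℚ_p`. -/
def pU : ℚ_[p]ˣ :=
  Units.mk0 (p : ℚ_[p]) (by
    have h := (Fact.out : p.Prime).ne_zero
    exact_mod_cast Nat.cast_ne_zero.mpr h)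

/-- Scalar matrices as elements of `G`. -/
def scalarGL (u : ℚ_[p]ˣ) : GG p N :=
  Units.map (algebraMap ℚ_[p] (Matrix (Fin N) (Fin N) ℚ_[p])).toMonoidHom u

/-- The central element `ϖ^n · Id`. -/
def piSc (n : ℤ) : GG p N := scalarGL p N (pU p ^ n)

/-- Invertible diagonal matrices. -/
def diagGL (d : Fin N → ℚ_[p]ˣ) : GG p N where
  val := Matrix.diagonal fun i => (d i : ℚ_[p])
  inv := Matrix.diagonal fun i => (((d i)⁻¹ : ℚ_[p]ˣ) : ℚ_[p])
  val_inv := by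
    rw [Matrix.diagonal_mul_diagonal]
    simp
  inv_val := by
    rw [Matrix.diagonal_mul_diagonal]
    simp

/-- extend `a ∈ ℤ^{N-1}` by `0` in the last coordinate. -/
def expo (a : Fin (N - 1) → ℤ) : Fin N → ℤ :=
  fun i => if h : (i : ℕ) < N - 1 then a ⟨i, h⟩ else 0

/-- `t_a = diag(ϖ^{a_1}, …, ϖ^{a_{N-1}}, 1)`. -/
def tGL (a : Fin (N - 1) → ℤ) : GG p N :=
  diagGL p N fun i => pU p ^ (expo N a i)

/-- The permutation matrix of `σ` (with `permGL σ · e_j = e_{σ j}`, so that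
`permGL` is a group homomorphism). -/
def permGL (σ : Equiv.Perm (Fin N)) : GG p N where
  val := (σ⁻¹).permMatrix ℚ_[p]
  inv := σ.permMatrix ℚ_[p]
  val_inv := by
    show ((σ⁻¹).toPEquiv.toMatrix : Matrix (Fin N) (Fin N) ℚ_[p]) * σ.toPEquiv.toMatrix = 1
    rw [← PEquiv.toMatrix_trans, ← Equiv.toPEquiv_trans]
    simp only [Equiv.self_trans_symm, Equiv.symm_trans_self, Equiv.Perm.inv_def]
    rw [Equiv.toPEquiv_refl, PEquiv.toMatrix_refl]
  inv_val := by
    show (σ.toPEquiv.toMatrix : Matrix (Fin N) (Fin N) ℚ_[p]) * (σ⁻¹).toPEquiv.toMatrix = 1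
    rw [← PEquiv.toMatrix_trans, ← Equiv.toPEquiv_trans]
    simp only [Equiv.self_trans_symm, Equiv.symm_trans_self, Equiv.Perm.inv_def]
    rw [Equiv.toPEquiv_refl, PEquiv.toMatrix_refl]

/-- `ω t_a`. -/
def wS (σ : Equiv.Perm (Fin N)) (a : Fin (N - 1) → ℤ) : GG p N :=
  permGL p N σ * tGL p N a

/-- The permutation `ω₂` (as a matrix: first row block `(0, I_{N-1})`, last row `(1,0,…,0)`). -/
def w2 : Equiv.Perm (Fin N) := (finRotate N)⁻¹

/-- `γ = ω₂ · diag(ϖ, I_{N-1})`. -/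
def gammaGL : GG p N :=
  permGL p N (w2 N) * tGL p N fun i => if (i : ℕ) = 0 then 1 else 0

/-- `S_ω = {a ∈ ℤ^{N-1} : (ω t_a) I (ω t_a)⁻¹ ∩ K ⊆ I}`. -/
def Sset (σ : Equiv.Perm (Fin N)) : Set (Fin (N - 1) → ℤ) :=
  {a | ∀ g ∈ Iset p N,
    wS p N σ a * g * (wS p N σ a)⁻¹ ∈ Kset p N →
    wS p N σ a * g * (wS p N σ a)⁻¹ ∈ Iset p N}

/-- The unit of `k_F^×` attached to a nonzero element of `k_F` (junk value `1` at `0`). -/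
def unitOf (x : ZMod p) : (ZMod p)ˣ :=
  if h : x = 0 then 1 else Units.mk0 x h

/-- The diagonal of the reduction of `m`, as an `N`-tuple of units of `k_F`. -/
def diagOf (m : MM p N) : Fin N → (ZMod p)ˣ :=
  fun i => unitOf p ((redM p N m : Matrix (Fin N) (Fin N) (ZMod p)) i i)

/-- The transformation rule for functions in `H_{IZ}(χ)`, where the character `χ` of `I`
is given by the character `ξ` of the torus `(k_F^×)^N` through the diagonal of the
reduction, extended to `IZ` by `χ(ϖ) = 1`. -/
def HTransf (ξ : (Fin N → (ZMod p)ˣ) →* (kb p)ˣ) (φ : GG p N → kb p) : Prop :=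
  ∀ (n₁ n₂ : ℤ) (m₁ m₂ : MM p N), m₁ ∈ Ipre p N → m₂ ∈ Ipre p N → ∀ g : GG p N,
    φ (piSc p N n₁ * iotaM p N m₁ * g * (piSc p N n₂ * iotaM p N m₂)) =
      (ξ (diagOf p N m₁) : kb p) * (ξ (diagOf p N m₂) : kb p) * φ g

/-- `φ` is supported on the double coset `IZ x I`. -/
def SuppDouble (φ : GG p N → kb p) (x : GG p N) : Prop :=
  ∀ g : GG p N, φ g ≠ 0 → ∃ (n : ℤ) (m₁ m₂ : MM p N), m₁ ∈ Ipre p N ∧ m₂ ∈ Ipre p N ∧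
    g = piSc p N n * iotaM p N m₁ * x * iotaM p N m₂

/-- Membership in `H_{IZ}(χ)`: the transformation rule together with support in
finitely many double cosets `IZ g I`. -/
def HMem (ξ : (Fin N → (ZMod p)ˣ) →* (kb p)ˣ) (φ : GG p N → kb p) : Prop :=
  HTransf p N ξ φ ∧
  ∃ S : Finset (GG p N), ∀ g : GG p N, φ g ≠ 0 →
    ∃ s ∈ S, ∃ (n : ℤ) (m₁ m₂ : MM p N), m₁ ∈ Ipre p N ∧ m₂ ∈ Ipre p N ∧
      g = piSc p N n * iotaM p N m₁ * s * iotaM p N m₂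

section Rep

variable {V : Type} [AddCommGroup V] [Module (kb p) V]

/-- `σ` (here `ρ`) is irreducible. -/
def IsIrred (ρ : Representation (kb p) (Gk p N) V) : Prop :=
  (∃ v : V, v ≠ 0) ∧
  ∀ W : Submodule (kb p) V, (∀ g v, v ∈ W → ρ g v ∈ W) → W = ⊥ ∨ W = ⊤

/-- Membership in the compact induction `ind_{KZ}^G σ`: left `KZ`-equivariance
(where `ϖ` acts trivially), support in finitely many cosets `KZ g`, and smoothness. -/
def IndMem (ρ : Representation (kb p) (Gk p N) V) (f : GG p N → V) : Prop :=
  (∀ (n : ℤ) (m : MM p N) (g : GG p N),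
      f (piSc p N n * iotaM p N m * g) = ρ (redM p N m) (f g)) ∧
  (∃ S : Finset (GG p N), ∀ g : GG p N, f g ≠ 0 →
      ∃ s ∈ S, ∃ (n : ℤ) (m : MM p N), g = piSc p N n * iotaM p N m * s) ∧
  (∃ U : Subgroup (GG p N), IsOpen (U : Set (GG p N)) ∧ ∀ u ∈ U, ∀ g, f (g * u) = f g)

/-- `f` is invariant under right translation by `I_1`. -/
def IsI1Inv (f : GG p N → V) : Prop :=
  ∀ u ∈ I1set p N, ∀ g, f (g * u) = f g

/-- The defining property of the standard function `f_{ω,a}`: an `I_1`-invariant member of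
`ind_{KZ}^G σ` supported on `KZ t_a I_1` with value `v₀` at `ω t_a`. -/
def IsStd (ρ : Representation (kb p) (Gk p N) V) (v₀ : V)
    (σp : Equiv.Perm (Fin N)) (a : Fin (N - 1) → ℤ) (f : GG p N → V) : Prop :=
  IndMem p N ρ f ∧ IsI1Inv p N f ∧
  (∀ g : GG p N, f g ≠ 0 → ∃ (n : ℤ) (m : MM p N) (u : GG p N), u ∈ I1set p N ∧
      g = piSc p N n * iotaM p N m * tGL p N a * u) ∧
  f (wS p N σp a) = v₀

/-- `R` is a set of representatives for `I_1/(I_1 ∩ g⁻¹ I_1 g)`. -/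
def IsRepSet (g : GG p N) (R : Finset (GG p N)) : Prop :=
  (↑R ⊆ I1set p N) ∧
  ∀ x ∈ I1set p N, ∃! r : GG p N, r ∈ R ∧
    (r⁻¹ * x ∈ I1set p N ∧ g * (r⁻¹ * x) * g⁻¹ ∈ I1set p N)

/-- The Hecke operator: `f|T_g = ∑_{r} (r g⁻¹)·f`, where `(h·f)(x) = f(xh)`. -/
def hk (g : GG p N) (R : Finset (GG p N)) (f : GG p N → V) : GG p N → V :=
  fun x => ∑ r ∈ R, f (x * r * g⁻¹)

end Rep

section Permutation

variable (N : ℕ)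

theorem permGL_mul_apply (σ : Equiv.Perm (Fin N)) (g : GG p N) (i j : Fin N) :
    (permGL p N σ * g : GG p N) i j = g (σ⁻¹ i) j := by
  change ((σ⁻¹).permMatrix ℚ_[p] * (g : Matrix (Fin N) (Fin N) ℚ_[p])) i j = _
  rw [PEquiv.toMatrix_toPEquiv_mul]
  rfl

theorem mul_permGL_inv_apply (σ : Equiv.Perm (Fin N)) (g : GG p N) (i j : Fin N) :
    (g * (permGL p N σ)⁻¹ : GG p N) i j = g i (σ⁻¹ j) := by
  change ((g : Matrix (Fin N) (Fin N) ℚ_[p]) * σ.permMatrix ℚ_[p]) i j = _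
  rw [PEquiv.mul_toMatrix_toPEquiv]
  rfl

theorem diagGL_mul_apply (d : Fin N → ℚ_[p]ˣ) (g : GG p N) (i j : Fin N) :
    (diagGL p N d * g : GG p N) i j = d i * g i j := by
  change (Matrix.diagonal (fun i => (d i : ℚ_[p])) * (g : Matrix (Fin N) (Fin N) ℚ_[p])) i j = _
  simp [Matrix.diagonal_mul]

theorem mul_diagGL_inv_apply (d : Fin N → ℚ_[p]ˣ) (g : GG p N) (i j : Fin N) :
    (g * (diagGL p N d)⁻¹ : GG p N) i j = g i j * (d j : ℚ_[p])⁻¹ := by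
  change ((g : Matrix (Fin N) (Fin N) ℚ_[p]) *
    Matrix.diagonal (fun i => (((d i)⁻¹ : ℚ_[p]ˣ) : ℚ_[p]))) i j = _
  simp [Matrix.mul_diagonal]

theorem diagGL_mul (d e : Fin N → ℚ_[p]ˣ) :
    diagGL p N d * diagGL p N e = diagGL p N (d * e) := by
  ext i j
  rw [diagGL_mul_apply]
  simp only [diagGL, Matrix.diagonal_apply, Pi.mul_apply, Units.val_mul]
  split_ifs <;> simp

theorem permGL_mul (σ τ : Equiv.Perm (Fin N)) :
    permGL p N (σ * τ) = permGL p N σ * permGL p N τ := by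
  ext i j
  have h (ν : Equiv.Perm (Fin N)) (i j : Fin N) :
      permGL p N ν i j = (1 : GG p N) (ν⁻¹ i) j := by
    rw [← permGL_mul_apply, mul_one]
  rw [permGL_mul_apply, h, h]
  simp

theorem diagGL_mul_permGL (d : Fin N → ℚ_[p]ˣ) (σ : Equiv.Perm (Fin N)) :
    diagGL p N d * permGL p N σ = permGL p N σ * diagGL p N (d ∘ σ) := by
  rw [← eq_mul_inv_iff_mul_eq]
  ext i j
  rw [mul_permGL_inv_apply, permGL_mul_apply]
  simp [diagGL, Matrix.diagonal_apply]

theorem piSc_eq_diagGL (k : ℤ) : piSc p N k = diagGL p N fun _ => pU p ^ k := by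
  ext i j
  exact congrFun (congrFun (Matrix.algebraMap_eq_diagonal ((pU p ^ k : ℚ_[p]ˣ) : ℚ_[p])) i) j

theorem piSc_mul_comm (k : ℤ) (g : GG p N) : piSc p N k * g = g * piSc p N k := by
  ext i j
  exact congrFun (congrFun (Algebra.commutes ((pU p ^ k : ℚ_[p]ˣ) : ℚ_[p])
    (g : Matrix (Fin N) (Fin N) ℚ_[p])) i) j

theorem piSc_add (k l : ℤ) : piSc p N (k + l) = piSc p N k * piSc p N l := by
  simp only [piSc, scalarGL, _root_.zpow_add, map_mul]

theorem exists_iotaM_eq_permGL (σ : Equiv.Perm (Fin N)) : ∃ m, iotaM p N m = permGL p N σ := by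
  refine ⟨⟨(σ⁻¹).permMatrix ℤ_[p], σ.permMatrix ℤ_[p], ?_, ?_⟩, ?_⟩
  · rw [← Matrix.permMatrix_mul]; simp
  · rw [← Matrix.permMatrix_mul]; simp
  · ext i j
    simp [iotaM, permGL, PEquiv.toMatrix_apply, Equiv.toPEquiv_apply, apply_ite]

end Permutation

section Iwahori

variable (N : ℕ)

/-- The bound that membership in the Iwahori subgroup imposes on the `(i, j)` entry. -/
def EntryBound (i j : Fin N) (x : ℚ_[p]) : Prop :=
  ‖x‖ ≤ 1 ∧ (j < i → ‖x‖ < 1)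

theorem toZMod_eq_zero_iff (x : ℤ_[p]) : PadicInt.toZMod x = 0 ↔ ‖(x : ℚ_[p])‖ < 1 := by
  rw [← RingHom.mem_ker, PadicInt.ker_toZMod, IsLocalRing.mem_maximalIdeal, PadicInt.mem_nonunits,
    PadicInt.norm_def]

theorem toZMod_eq_one_iff (x : ℤ_[p]) : PadicInt.toZMod x = 1 ↔ ‖(x : ℚ_[p]) - 1‖ < 1 := by
  rw [← sub_eq_zero, ← map_one PadicInt.toZMod, ← map_sub, toZMod_eq_zero_iff]
  simp

theorem iotaM_apply (m : MM p N) (i j : Fin N) : iotaM p N m i j = (m i j : ℚ_[p]) := rfl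

theorem redM_apply (m : MM p N) (i j : Fin N) :
    redM p N m i j = PadicInt.toZMod (m i j) := rfl

theorem exists_iotaM_eq {g : GG p N} (hg : ∀ i j, ‖g i j‖ ≤ 1)
    (hdet : ‖(g : Matrix (Fin N) (Fin N) ℚ_[p]).det‖ = 1) : ∃ m, iotaM p N m = g := by
  let M : Matrix (Fin N) (Fin N) ℤ_[p] := Matrix.of fun i j => ⟨g i j, hg i j⟩
  have hM : PadicInt.Coe.ringHom.mapMatrix M = (g : Matrix (Fin N) (Fin N) ℚ_[p]) := rfl
  have hMdet : ((M.det : ℤ_[p]) : ℚ_[p]) = (g : Matrix (Fin N) (Fin N) ℚ_[p]).det := by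
    rw [← hM]
    exact RingHom.map_det PadicInt.Coe.ringHom M
  have hu : IsUnit M.det := by
    rw [PadicInt.isUnit_iff, PadicInt.norm_def, hMdet, hdet]
  exact ⟨Matrix.GeneralLinearGroup.mk'' M hu, Units.ext hM⟩

theorem norm_det_iotaM (m : MM p N) :
    ‖(iotaM p N m : Matrix (Fin N) (Fin N) ℚ_[p]).det‖ = 1 := by
  have h : (iotaM p N m : Matrix (Fin N) (Fin N) ℚ_[p]) =
    PadicInt.Coe.ringHom.mapMatrix (m : Matrix (Fin N) (Fin N) ℤ_[p]) := rfl
  have hu := (Matrix.isUnit_iff_isUnit_det _).1 m.isUnit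
  rw [PadicInt.isUnit_iff, PadicInt.norm_def] at hu
  rw [h, ← RingHom.map_det]
  exact hu

theorem mem_Ipre_iff (m : MM p N) :
    m ∈ Ipre p N ↔ ∀ i j, EntryBound p N i j (iotaM p N m i j) := by
  simp only [Ipre, Set.mem_ofPred_eq, redM_apply, toZMod_eq_zero_iff, EntryBound, iotaM_apply]
  exact forall₂_congr fun i j => ⟨fun h => ⟨PadicInt.norm_le_one _, h⟩, And.right⟩

theorem mem_Iset_iff (g : GG p N) :
    g ∈ Iset p N ↔ (∀ i j, EntryBound p N i j (g i j)) ∧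
      ‖(g : Matrix (Fin N) (Fin N) ℚ_[p]).det‖ = 1 := by
  constructor
  · rintro ⟨m, hm, rfl⟩
    exact ⟨(mem_Ipre_iff p N m).1 hm, norm_det_iotaM p N m⟩
  · rintro ⟨hg, hdet⟩
    obtain ⟨m, rfl⟩ := exists_iotaM_eq p N (fun i j => (hg i j).1) hdet
    exact ⟨m, (mem_Ipre_iff p N m).2 hg, rfl⟩

theorem mem_I1set_iff (g : GG p N) :
    g ∈ I1set p N ↔ g ∈ Iset p N ∧ ∀ i, ‖g i i - 1‖ < 1 := by
  constructor
  · rintro ⟨m, ⟨hm, hd⟩, rfl⟩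
    exact ⟨⟨m, hm, rfl⟩, fun i => (toZMod_eq_one_iff p _).1 (hd i)⟩
  · rintro ⟨⟨m, hm, rfl⟩, hd⟩
    exact ⟨m, ⟨hm, fun i => (toZMod_eq_one_iff p _).2 (hd i)⟩, rfl⟩

theorem one_mem_I1set : (1 : GG p N) ∈ I1set p N :=
  ⟨1, ⟨fun i j h => by simp [h.ne'], fun i => by simp⟩, map_one _⟩

theorem inv_mem_I1set {x : GG p N} (hx : x ∈ I1set p N) : x⁻¹ ∈ I1set p N := by
  obtain ⟨m, ⟨hm, hd⟩, rfl⟩ := hx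
  let A : Matrix (Fin N) (Fin N) (ZMod p) := redM p N m
  let B : Matrix (Fin N) (Fin N) (ZMod p) := ((redM p N m)⁻¹ : Gk p N)
  have hA : A.BlockTriangular id := fun i j h => hm i j h
  have hB : B.BlockTriangular id := by
    let : Invertible A := (redM p N m).invertible
    have h := Matrix.blockTriangular_inv_of_blockTriangular hA
    rwa [← Matrix.coe_units_inv] at h
  refine ⟨m⁻¹, ⟨fun i j h => ?_, fun i => ?_⟩, map_inv _ _⟩
  · rw [map_inv]
    exact hB h
  · rw [map_inv]
    have hAB : (A * B) i i = 1 := by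
      rw [show A * B = 1 from (redM p N m).mul_inv, Matrix.one_apply_eq]
    rw [Matrix.mul_apply, Finset.sum_eq_single i, show A i i = 1 from hd i, one_mul] at hAB
    · exact hAB
    · intro k _ hk
      rcases hk.lt_or_gt with h | h
      · rw [hA h, zero_mul]
      · rw [hB h, mul_zero]
    · simp

end Iwahori

section Gamma

variable (n : ℕ)

/-- The diagonal `(ϖ, 1, …, 1)`. -/
def gammaDiag (i : Fin (n + 3)) : ℚ_[p]ˣ := if i = 0 then pU p else 1

theorem gammaGL_eq :
    gammaGL p (n + 3) = permGL p (n + 3) (w2 (n + 3)) * diagGL p (n + 3) (gammaDiag p n) := by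
  unfold gammaGL tGL
  congr 2
  funext i
  by_cases h : i = 0
  · simp [h, expo, gammaDiag]
  · have h' : (i : ℕ) ≠ 0 := fun h' => h (Fin.ext h')
    simp [h, h', expo, gammaDiag]

theorem gammaGL_conj_apply (g : GG p (n + 3)) (i j : Fin (n + 3)) :
    (gammaGL p (n + 3) * g * (gammaGL p (n + 3))⁻¹ : GG p (n + 3)) i j =
      gammaDiag p n (finRotate _ i) * g (finRotate _ i) (finRotate _ j) *
        (gammaDiag p n (finRotate _ j) : ℚ_[p])⁻¹ := by
  have h : gammaGL p (n + 3) * g * (gammaGL p (n + 3))⁻¹ =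
      permGL p (n + 3) (w2 (n + 3)) * (diagGL p (n + 3) (gammaDiag p n) * g *
        (diagGL p (n + 3) (gammaDiag p n))⁻¹) * (permGL p (n + 3) (w2 (n + 3)))⁻¹ := by
    rw [gammaGL_eq]; group
  rw [h, mul_permGL_inv_apply, permGL_mul_apply, mul_diagGL_inv_apply, diagGL_mul_apply]
  simp [w2]

theorem norm_p_mul_lt_one_iff (x : ℚ_[p]) : ‖(p : ℚ_[p]) * x‖ < 1 ↔ ‖x‖ ≤ 1 := by
  have hp : (0 : ℝ) < p := by exact_mod_cast (Fact.out : p.Prime).pos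
  have h := Padic.norm_le_pow_iff_norm_lt_pow_add_one x 0
  rw [zpow_zero, zero_add, zpow_one] at h
  rw [h, norm_mul, Padic.norm_p, inv_mul_lt_iff₀ hp, mul_one]

theorem norm_mul_p_inv_le_one_iff (x : ℚ_[p]) : ‖x * (p : ℚ_[p])⁻¹‖ ≤ 1 ↔ ‖x‖ < 1 := by
  have hp : (p : ℚ_[p]) ≠ 0 := (pU p).ne_zero
  rw [← norm_p_mul_lt_one_iff, mul_comm x, mul_inv_cancel_left₀ hp]

theorem entryBound_gammaDiag_iff (i j : Fin (n + 3)) (x : ℚ_[p]) :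
    EntryBound p (n + 3) i j (gammaDiag p n (finRotate _ i) * x *
      (gammaDiag p n (finRotate _ j) : ℚ_[p])⁻¹) ↔
    EntryBound p (n + 3) (finRotate _ i) (finRotate _ j) x := by
  have hp : (p : ℚ_[p]) ≠ 0 := (pU p).ne_zero
  have hrot (k : Fin (n + 3)) : finRotate (n + 3) k = 0 ↔ k = Fin.last (n + 2) := by
    rw [← finRotate_last, (finRotate (n + 3)).injective.eq_iff]
  have hval (k : Fin (n + 3)) (hk : k ≠ Fin.last (n + 2)) : (finRotate (n + 3) k : ℕ) = k + 1 :=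
    coe_finRotate_of_ne_last hk
  have hlt (k : Fin (n + 3)) (hk : k ≠ Fin.last (n + 2)) : k < Fin.last (n + 2) :=
    Fin.lt_last_iff_ne_last.2 hk
  have hpU : (pU p : ℚ_[p]) = p := rfl
  unfold EntryBound gammaDiag
  by_cases hi : i = Fin.last (n + 2) <;> by_cases hj : j = Fin.last (n + 2)
  · subst hi hj
    simp [hpU, mul_comm (p : ℚ_[p]) x, hp]
  · subst hi
    have h : ¬ finRotate (n + 3) j < 0 := not_lt_bot
    simp only [hrot, hj, hlt j hj, finRotate_last, h, if_true, if_false, Units.val_one, inv_one,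
      mul_one, hpU, norm_p_mul_lt_one_iff, forall_const, IsEmpty.forall_iff, and_true]
    exact ⟨And.right, fun h => ⟨((norm_p_mul_lt_one_iff p x).2 h).le, h⟩⟩
  · subst hj
    have h : (0 : Fin (n + 3)) < finRotate (n + 3) i :=
      Fin.pos_iff_ne_zero.2 fun h => hi ((hrot i).1 h)
    simp only [hrot, hi, finRotate_last, h, if_true, if_false, Units.val_one, one_mul, hpU,
      norm_mul_p_inv_le_one_iff, forall_const, (hlt i hi).not_gt, IsEmpty.forall_iff, and_true]
    exact ⟨fun h => ⟨h.le, h⟩, And.right⟩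
  · simp only [hrot, hi, hj, if_false, Units.val_one, inv_one, mul_one, one_mul]
    simp only [Fin.lt_def, hval i hi, hval j hj, add_lt_add_iff_right]

theorem gammaGL_conj_mem_Iset_iff (g : GG p (n + 3)) :
    gammaGL p (n + 3) * g * (gammaGL p (n + 3))⁻¹ ∈ Iset p (n + 3) ↔ g ∈ Iset p (n + 3) := by
  have hdet : ((gammaGL p (n + 3) * g * (gammaGL p (n + 3))⁻¹ : GG p (n + 3)) :
      Matrix (Fin (n + 3)) (Fin (n + 3)) ℚ_[p]).det =
      (g : Matrix (Fin (n + 3)) (Fin (n + 3)) ℚ_[p]).det :=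
    Matrix.det_units_conj (gammaGL p (n + 3)) _
  simp only [mem_Iset_iff, hdet, gammaGL_conj_apply, entryBound_gammaDiag_iff]
  refine and_congr_left fun _ => ⟨fun h i j => ?_, fun h i j => h _ _⟩
  simpa using h ((finRotate _).symm i) ((finRotate _).symm j)

theorem gammaGL_conj_mem_I1set_iff (g : GG p (n + 3)) :
    gammaGL p (n + 3) * g * (gammaGL p (n + 3))⁻¹ ∈ I1set p (n + 3) ↔ g ∈ I1set p (n + 3) := by
  have hd (i : Fin (n + 3)) (x : ℚ_[p]) :
      gammaDiag p n i * x * (gammaDiag p n i : ℚ_[p])⁻¹ = x := by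
    rw [mul_comm, inv_mul_cancel_left₀ (gammaDiag p n i).ne_zero]
  simp only [mem_I1set_iff, gammaGL_conj_mem_Iset_iff, gammaGL_conj_apply, hd]
  refine and_congr_right fun _ => ⟨fun h i => ?_, fun h i => h _⟩
  simpa using h ((finRotate _).symm i)

/-- The vector `γ·a`. -/
abbrev gammaAct (a : Fin (n + 2) → ℤ) : Fin (n + 2) → ℤ := fun i : Fin (n + 2) =>
  if (i : ℕ) = 0 then 1 - a ⟨n + 1, Nat.lt_succ_self _⟩
  else a ⟨(i : ℕ) - 1, lt_of_le_of_lt (Nat.sub_le _ _) i.isLt⟩ -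
    a ⟨n + 1, Nat.lt_succ_self _⟩

theorem expo_gammaAct (a : Fin (n + 2) → ℤ) (i : Fin (n + 3)) :
    expo (n + 3) (gammaAct n a) i =
      -a ⟨n + 1, Nat.lt_succ_self _⟩ + expo (n + 3) a (w2 (n + 3) i) + if i = 0 then 1 else 0 := by
  obtain ⟨k, rfl⟩ := (finRotate (n + 3)).surjective i
  have hw : w2 (n + 3) (finRotate (n + 3) k) = k := by simp [w2]
  rw [hw]
  by_cases hk : k = Fin.last (n + 2)
  · subst hk
    simp [expo, gammaAct]
    ring
  · have hv : (finRotate (n + 3) k : ℕ) = k + 1 := coe_finRotate_of_ne_last hk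
    have hlt : (k : ℕ) < n + 2 := Fin.lt_last_iff_ne_last.2 hk
    generalize finRotate (n + 3) k = i at hv
    have h0 : i ≠ 0 := fun h => by simp [h] at hv
    by_cases hk' : (k : ℕ) + 1 < n + 2
    · simp [expo, gammaAct, hv, hlt, h0, hk']
      ring
    · have : (k : ℕ) = n + 1 := by omega
      simp [expo, this, hv, h0]

theorem wS_gammaAct (ω : Equiv.Perm (Fin (n + 3))) (a : Fin (n + 2) → ℤ) :
    wS p (n + 3) (ω * w2 (n + 3)) (gammaAct n a) =
      piSc p (n + 3) (-a ⟨n + 1, Nat.lt_succ_self _⟩) * wS p (n + 3) ω a * gammaGL p (n + 3) := by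
  rw [gammaGL_eq]
  have h : tGL p (n + 3) (gammaAct n a) =
      diagGL p (n + 3) ((fun i => pU p ^ expo (n + 3) a i) ∘ w2 (n + 3)) *
        diagGL p (n + 3) (gammaDiag p n) * piSc p (n + 3) (-a ⟨n + 1, Nat.lt_succ_self _⟩) := by
    rw [piSc_eq_diagGL, diagGL_mul, diagGL_mul]
    unfold tGL
    congr 1
    funext i
    rw [expo_gammaAct, _root_.zpow_add, _root_.zpow_add]
    by_cases hi : i = 0 <;> simp [gammaDiag, hi, mul_comm, mul_left_comm]
  rw [wS, h, permGL_mul, wS, tGL]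
  simp only [mul_assoc]
  rw [piSc_mul_comm, ← mul_assoc (diagGL p (n + 3) _) (permGL p (n + 3) (w2 (n + 3))),
    diagGL_mul_permGL]
  simp only [mul_assoc]

end Gamma

section Standard

variable (N : ℕ) {V : Type} [AddCommGroup V] [Module (kb p) V]

/-- The support of a standard function, written with `ω t_a` in place of `t_a`. -/
theorem IsStd.exists_eq_of_ne_zero {ρ : Representation (kb p) (Gk p N) V} {v₀ : V}
    {σ : Equiv.Perm (Fin N)} {a : Fin (N - 1) → ℤ} {f : GG p N → V} (hf : IsStd p N ρ v₀ σ a f)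
    {g : GG p N} (hg : f g ≠ 0) : ∃ (k : ℤ) (m : MM p N) (u : GG p N), u ∈ I1set p N ∧
      g = piSc p N k * iotaM p N m * wS p N σ a * u := by
  obtain ⟨k, m, u, hu, rfl⟩ := hf.2.2.1 g hg
  obtain ⟨q, hq⟩ := exists_iotaM_eq_permGL p N σ
  refine ⟨k, m * q⁻¹, u, hu, ?_⟩
  rw [wS, map_mul, map_inv, hq]
  group

theorem IsStd.apply {ρ : Representation (kb p) (Gk p N) V} {v₀ : V}
    {σ : Equiv.Perm (Fin N)} {a : Fin (N - 1) → ℤ} {f : GG p N → V} (hf : IsStd p N ρ v₀ σ a f)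
    (k : ℤ) (m : MM p N) {u : GG p N} (hu : u ∈ I1set p N) :
    f (piSc p N k * iotaM p N m * wS p N σ a * u) = ρ (redM p N m) v₀ := by
  rw [hf.2.1 u hu, hf.1.1, hf.2.2.2]

end Standard

section Hecke

/-- As `γ` normalizes `I_1`, the operator `T_γ` is translation by `γ⁻¹`. -/
theorem hk_gammaGL_apply (n : ℕ) {V : Type} [AddCommGroup V] {f : GG p (n + 3) → V} (hf : IsI1Inv p (n + 3) f)
    {R : Finset (GG p (n + 3))} (hR : IsRepSet p (n + 3) (gammaGL p (n + 3)) R)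
    (x : GG p (n + 3)) :
    hk p (n + 3) (gammaGL p (n + 3)) R f x = f (x * (gammaGL p (n + 3))⁻¹) := by
  obtain ⟨r, ⟨hr, -⟩, huniq⟩ := hR.2 1 (one_mem_I1set p (n + 3))
  have hsing : R = {r} := by
    refine Finset.eq_singleton_iff_unique_mem.2 ⟨hr, fun s hs => huniq s ⟨hs, ?_⟩⟩
    rw [mul_one]
    have := inv_mem_I1set p (n + 3) (hR.1 hs)
    exact ⟨this, (gammaGL_conj_mem_I1set_iff p n _).2 this⟩
  have hx : x * r * (gammaGL p (n + 3))⁻¹ =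
      x * (gammaGL p (n + 3))⁻¹ * (gammaGL p (n + 3) * r * (gammaGL p (n + 3))⁻¹) := by group
  rw [hk, hsing, Finset.sum_singleton, hx, hf _ ((gammaGL_conj_mem_I1set_iff p n r).2 (hR.1 hr))]

end Hecke

/-- in the Iwahori–Hecke (degenerate) case, `γ·a ∈ S_{ω ω₂}` and
`f_{ω,a}|T_γ = f_{ω ω₂, γ·a}`. -/
theorem stmt12 (p : ℕ) [Fact p.Prime] (n : ℕ)
    {V : Type} [AddCommGroup V] [Module (kb p) V] [FiniteDimensional (kb p) V]
    (ρ : Representation (kb p) (Gk p (n + 3)) V) (hirr : IsIrred p (n + 3) ρ)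
    (v₀ : V) (hv₀ : v₀ ≠ 0)
    (hfix : ∀ m ∈ I1pre p (n + 3), ρ (redM p (n + 3) m) v₀ = v₀)
    (ξ : (Fin (n + 3) → (ZMod p)ˣ) →* (kb p)ˣ)
    (hχ : ∀ m ∈ Ipre p (n + 3),
      ρ (redM p (n + 3) m) v₀ = (ξ (diagOf p (n + 3) m) : kb p) • v₀)
    (hdeg : ∀ (ν : Equiv.Perm (Fin (n + 3))) (d : Fin (n + 3) → (ZMod p)ˣ),
      ξ (d ∘ ⇑ν⁻¹) = ξ d)
    (ω : Equiv.Perm (Fin (n + 3))) (a : Fin (n + 2) → ℤ) (ha : a ∈ Sset p (n + 3) ω) :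
    (fun i : Fin (n + 2) =>
        if (i : ℕ) = 0 then 1 - a ⟨n + 1, Nat.lt_succ_self _⟩
        else a ⟨(i : ℕ) - 1, lt_of_le_of_lt (Nat.sub_le _ _) i.isLt⟩ -
          a ⟨n + 1, Nat.lt_succ_self _⟩) ∈
      Sset p (n + 3) (ω * w2 (n + 3)) ∧
    ∀ f f' : GG p (n + 3) → V, IsStd p (n + 3) ρ v₀ ω a f →
      IsStd p (n + 3) ρ v₀ (ω * w2 (n + 3))
        (fun i : Fin (n + 2) =>
          if (i : ℕ) = 0 then 1 - a ⟨n + 1, Nat.lt_succ_self _⟩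
          else a ⟨(i : ℕ) - 1, lt_of_le_of_lt (Nat.sub_le _ _) i.isLt⟩ -
            a ⟨n + 1, Nat.lt_succ_self _⟩) f' →
      ∀ R : Finset (GG p (n + 3)), IsRepSet p (n + 3) (gammaGL p (n + 3)) R →
        hk p (n + 3) (gammaGL p (n + 3)) R f = f' := by
  have hwS := wS_gammaAct p n ω a
  set c : ℤ := a ⟨n + 1, Nat.lt_succ_self _⟩
  set γ := gammaGL p (n + 3) with hγ
  refine ⟨?_, fun f f' hf hf' R hR => funext fun x => ?_⟩
  · intro g hg
    have hconj : wS p (n + 3) (ω * w2 (n + 3)) (gammaAct n a) * g *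
        (wS p (n + 3) (ω * w2 (n + 3)) (gammaAct n a))⁻¹ =
        wS p (n + 3) ω a * (γ * g * γ⁻¹) * (wS p (n + 3) ω a)⁻¹ := by
      have h := piSc_mul_comm p (n + 3) (-c)
        (wS p (n + 3) ω a * (γ * g * γ⁻¹) * (wS p (n + 3) ω a)⁻¹)
      rw [← mul_inv_eq_iff_eq_mul] at h
      rw [hwS, ← h]
      group
    change wS p (n + 3) (ω * w2 (n + 3)) (gammaAct n a) * g *
        (wS p (n + 3) (ω * w2 (n + 3)) (gammaAct n a))⁻¹ ∈ _ →
      wS p (n + 3) (ω * w2 (n + 3)) (gammaAct n a) * g *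
        (wS p (n + 3) (ω * w2 (n + 3)) (gammaAct n a))⁻¹ ∈ _
    rw [hconj]
    exact ha _ ((gammaGL_conj_mem_Iset_iff p n g).2 hg)
  · change IsStd p (n + 3) ρ v₀ (ω * w2 (n + 3)) (gammaAct n a) f' at hf'
    rw [hk_gammaGL_apply p n hf.2.1 hR]
    have key (k : ℤ) (m : MM p (n + 3)) (u : GG p (n + 3)) (hu : u ∈ I1set p (n + 3)) :
        f (piSc p (n + 3) k * iotaM p (n + 3) m * wS p (n + 3) (ω * w2 (n + 3)) (gammaAct n a) *
            u * γ⁻¹) =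
          f' (piSc p (n + 3) k * iotaM p (n + 3) m *
            wS p (n + 3) (ω * w2 (n + 3)) (gammaAct n a) * u) := by
      have h : piSc p (n + 3) k * iotaM p (n + 3) m *
          wS p (n + 3) (ω * w2 (n + 3)) (gammaAct n a) * u * γ⁻¹ =
          piSc p (n + 3) (k + -c) * iotaM p (n + 3) m * wS p (n + 3) ω a * (γ * u * γ⁻¹) := by
        rw [hwS, piSc_add, mul_assoc (piSc p (n + 3) k) (piSc p (n + 3) (-c)),
          piSc_mul_comm p (n + 3) (-c) (iotaM p (n + 3) m)]
        simp only [mul_assoc]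
      rw [h, hf.apply p _ _ _ ((gammaGL_conj_mem_I1set_iff p n u).2 hu), hf'.apply p _ _ _ hu]
    by_cases hx' : f' x = 0
    · by_contra hne
      rw [hx'] at hne
      obtain ⟨k, m, u, hu, hxe⟩ := hf.exists_eq_of_ne_zero p _ hne
      have hu' : γ⁻¹ * u * γ ∈ I1set p (n + 3) := by
        rw [← gammaGL_conj_mem_I1set_iff p n]
        convert hu using 1
        rw [← hγ]; group
      have hx : x = piSc p (n + 3) (k + c) * iotaM p (n + 3) m *
          wS p (n + 3) (ω * w2 (n + 3)) (gammaAct n a) * (γ⁻¹ * u * γ) := by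
        rw [mul_inv_eq_iff_eq_mul] at hxe
        have hc : piSc p (n + 3) (k + c) * iotaM p (n + 3) m * piSc p (n + 3) (-c) =
            piSc p (n + 3) k * iotaM p (n + 3) m := by
          rw [mul_assoc, ← piSc_mul_comm, ← mul_assoc, ← piSc_add, add_neg_cancel_right]
        rw [hxe, hwS, ← hc, ← hγ]
        group
      exact hne (by rw [hx, key _ _ _ hu', ← hx, hx'])
    · obtain ⟨k, m, u, hu, rfl⟩ := hf'.exists_eq_of_ne_zero p _ hx'
      exact key k m u hu

end IH
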